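/- arXiv:2110.15176 — 5 statements merged into one kernel-verified Lean document; each statement's English description precedes it below -/
import Mathlib

section
/- Let {B_{k|0}}_{k=0}^{d-1} and {B_{k|1}}_{k=0}^{d-1} be Fourier families on ℂ^n and define the steering operator B̂_d(α) = ∑_{k=1}^{d-1} ( Z_d^k ⊗ B_{k|0} + γ(α)·X_d^k ⊗ B_{k|1} + δ_k(α)·Z_d^k ⊗ 𝟙_n ) acting on ℂ^d ⊗ ℂ^n. Then for every unit vector ψ ∈ ℂ^d ⊗ ℂ^n one has Re⟨ψ, B̂_d(α) ψ⟩ ≤ d (the maximal quantum value of the steering functional is at most d). -/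
open Matrix Kronecker Finset
open scoped ComplexOrder

noncomputable section

/-- `ω = exp(2πi/d)`. -/
def om (d : ℕ) : ℂ := Complex.exp (2 * Real.pi * Complex.I / d)

/-- The generalized Pauli matrix `Z_d = ∑_i ω^i |i⟩⟨i|`. -/
def Zd (d : ℕ) : Matrix (Fin d) (Fin d) ℂ :=
  Matrix.diagonal fun i => om d ^ (i : ℕ)

/-- The generalized Pauli matrix `X_d = ∑_i |i+1 mod d⟩⟨i|`. -/
def Xd (d : ℕ) : Matrix (Fin d) (Fin d) ℂ :=
  Matrix.of fun i j => if (i : ℕ) = ((j : ℕ) + 1) % d then 1 else 0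

/-- `γ(α) = d / ∑_{i≠j} α_i/α_j` (sum over ordered pairs `i ≠ j`). -/
def gam (d : ℕ) (α : Fin d → ℝ) : ℝ :=
  d / ∑ i : Fin d, ∑ j : Fin d, if i ≠ j then α i / α j else 0

/-- `δ_k(α) = -(γ(α)/d) ∑_{i≠j} (α_i/α_j) ω^{k(d-j)}`. -/
def delt (d : ℕ) (α : Fin d → ℝ) (k : ℕ) : ℂ :=
  -(((gam d α : ℝ) : ℂ) / d) * ∑ i : Fin d, ∑ j : Fin d,
    if i ≠ j then ((α i / α j : ℝ) : ℂ) * om d ^ (k * (d - (j : ℕ))) else 0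

/-- A Fourier family on `ℂ^n`: `B 0 = 1`, `Bₖ†Bₖ ≤ 𝟙`, and `B_{d-k} = Bₖ†` (the latter stated
via negation in `Fin d`). -/
def IsFourierFamily (d n : ℕ) (B : Fin d → Matrix (Fin n) (Fin n) ℂ) : Prop :=
  (∀ k : Fin d, (k : ℕ) = 0 → B k = 1) ∧
  (∀ k : Fin d, ((1 : Matrix (Fin n) (Fin n) ℂ) - (B k)ᴴ * B k).PosSemidef) ∧
  (∀ k : Fin d, B (-k) = (B k)ᴴ)

/-- The steering operator
`B̂_d(α) = ∑_{k=1}^{d-1} (Z_d^k ⊗ B_{k|0} + γ(α)·X_d^k ⊗ B_{k|1} + δ_k(α)·Z_d^k ⊗ 𝟙_n)`. -/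
def steerOp (d n : ℕ) (α : Fin d → ℝ) (B0 B1 : Fin d → Matrix (Fin n) (Fin n) ℂ) :
    Matrix (Fin d × Fin n) (Fin d × Fin n) ℂ :=
  ∑ k ∈ Finset.univ.filter (fun k : Fin d => (k : ℕ) ≠ 0),
    ((Zd d ^ (k : ℕ)) ⊗ₖ B0 k
      + ((gam d α : ℝ) : ℂ) • ((Xd d ^ (k : ℕ)) ⊗ₖ B1 k)
      + delt d α (k : ℕ) • ((Zd d ^ (k : ℕ)) ⊗ₖ (1 : Matrix (Fin n) (Fin n) ℂ)))



/-- squared norm -/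
def nsq {n : ℕ} (x : Fin n → ℂ) : ℝ := ∑ m, Complex.normSq (x m)

lemma nsq_nonneg {n : ℕ} (x : Fin n → ℂ) : 0 ≤ nsq x :=
  Finset.sum_nonneg fun _ _ => Complex.normSq_nonneg _

lemma dot_self {n : ℕ} (x : Fin n → ℂ) : star x ⬝ᵥ x = (nsq x : ℂ) := by
  simp [dotProduct, nsq, Complex.normSq_eq_conj_mul_self]

lemma nsq_mulVec_le {n : ℕ} (B : Matrix (Fin n) (Fin n) ℂ)
    (hB : ((1 : Matrix (Fin n) (Fin n) ℂ) - Bᴴ * B).PosSemidef) (y : Fin n → ℂ) :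
    nsq (B *ᵥ y) ≤ nsq y := by
  have h := hB.dotProduct_mulVec_nonneg y
  have e : star y ⬝ᵥ (1 - Bᴴ * B) *ᵥ y = ((nsq y - nsq (B *ᵥ y) : ℝ) : ℂ) := by
    rw [Complex.ofReal_sub, ← dot_self, ← dot_self, sub_mulVec, one_mulVec, dotProduct_sub,
      star_mulVec, ← mulVec_mulVec, dotProduct_mulVec (star y) Bᴴ]
  rw [e] at h
  have : (0:ℝ) ≤ nsq y - nsq (B *ᵥ y) := by exact_mod_cast h
  linarith

lemma re_dot_le {n : ℕ} (B : Matrix (Fin n) (Fin n) ℂ)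
    (hB : ((1 : Matrix (Fin n) (Fin n) ℂ) - Bᴴ * B).PosSemidef) (x y : Fin n → ℂ)
    (c : ℂ) (hc : Complex.normSq c = 1) (a : ℝ) (ha : 0 < a) :
    (c * (star x ⬝ᵥ B *ᵥ y)).re ≤ (a * nsq y + a⁻¹ * nsq x) / 2 := by
  have h1 := nsq_mulVec_le B hB y
  set z := B *ᵥ y
  have h2 : nsq (fun m => x m - a * c * z m) =
      nsq x - 2 * a * (c * (star x ⬝ᵥ z)).re + a ^ 2 * nsq z := by
    simp only [nsq, dotProduct, Finset.mul_sum, Complex.re_sum, ← Finset.sum_sub_distrib,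
      ← Finset.sum_add_distrib]
    refine Finset.sum_congr rfl fun m _ => ?_
    rw [← one_mul (Complex.normSq (z m)), ← hc]
    simp [Complex.normSq_apply]
    ring
  have h3 := nsq_nonneg (fun m => x m - a * c * z m)
  rw [h2] at h3
  have h4 : a ^ 2 * nsq z ≤ a ^ 2 * nsq y := by gcongr
  have h5 : (a * nsq y + a⁻¹ * nsq x) / 2 = (a ^ 2 * nsq y + nsq x) / (2 * a) := by
    field_simp
  rw [h5, le_div_iff₀ (by positivity)]
  linarith

lemma quad_kron {d n : ℕ} (A : Matrix (Fin d) (Fin d) ℂ) (B : Matrix (Fin n) (Fin n) ℂ)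
    (ψ : Fin d × Fin n → ℂ) :
    star ψ ⬝ᵥ (A ⊗ₖ B) *ᵥ ψ =
      ∑ i, ∑ j, A i j * (star (fun m => ψ (i, m)) ⬝ᵥ B *ᵥ (fun m => ψ (j, m))) := by
  simp only [dotProduct, mulVec, Fintype.sum_prod_type, kroneckerMap_apply, Finset.mul_sum,
    Pi.star_apply]
  refine Finset.sum_congr rfl fun i _ => ?_
  rw [Finset.sum_comm]
  refine Finset.sum_congr rfl fun j _ => ?_
  refine Finset.sum_congr rfl fun m _ => ?_
  refine Finset.sum_congr rfl fun l _ => ?_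
  ring

lemma om_prim (d : ℕ) (hd : d ≠ 0) : IsPrimitiveRoot (om d) d :=
  Complex.isPrimitiveRoot_exp d hd

lemma normSq_om (d : ℕ) (hd : d ≠ 0) (k : ℕ) : Complex.normSq (om d ^ k) = 1 := by
  rw [map_pow, Complex.normSq_eq_norm_sq, (om_prim d hd).norm'_eq_one hd]
  simp

lemma Zd_pow (d k : ℕ) : Zd d ^ k = Matrix.diagonal fun i : Fin d => om d ^ ((i : ℕ) * k) := by
  rw [Zd, Matrix.diagonal_pow]
  congr 1
  funext i
  simp [pow_mul]

lemma Xd_pow (d k : ℕ) [NeZero d] (i j : Fin d) :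
    (Xd d ^ k) i j = if (i : ℕ) = ((j : ℕ) + k) % d then 1 else 0 := by
  induction k generalizing i j with
  | zero => simp [Matrix.one_apply, Nat.mod_eq_of_lt j.2, Fin.ext_iff]
  | succ k ih =>
    rw [pow_succ, Matrix.mul_apply]
    have hlt : ((j : ℕ) + 1) % d < d := Nat.mod_lt _ (NeZero.pos d)
    rw [Finset.sum_eq_single (⟨((j : ℕ) + 1) % d, hlt⟩ : Fin d)]
    · rw [ih]
      have e : ((j : ℕ) + (k + 1)) % d = (((j : ℕ) + 1) % d + k) % d := by
        rw [Nat.mod_add_mod]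
        congr 1
        ring
      simp [Xd, e]
    · intro b _ hb
      have : ¬ ((b : ℕ) = ((j : ℕ) + 1) % d) := fun h => hb (Fin.ext h)
      simp [Xd, this]
    · simp

lemma root_sum (d : ℕ) (hd : 2 ≤ d) (l j : Fin d) :
    ∑ k : Fin d, om d ^ ((k : ℕ) * (d - (j : ℕ))) * om d ^ ((l : ℕ) * k) =
      if j = l then (d : ℂ) else 0 := by
  have hp := om_prim d (by omega)
  have e : ∀ k : Fin d, om d ^ ((k : ℕ) * (d - (j : ℕ))) * om d ^ ((l : ℕ) * k) =
      (om d ^ (d - (j : ℕ) + l)) ^ (k : ℕ) := by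
    intro k
    rw [← pow_add, ← pow_mul]
    congr 1
    ring
  simp_rw [e]
  rw [Fin.sum_univ_eq_sum_range (fun k => (om d ^ (d - (j : ℕ) + l)) ^ k) d]
  split_ifs with h
  · subst h
    rw [Nat.sub_add_cancel j.2.le, hp.pow_eq_one]
    simp
  · have hne : om d ^ (d - (j : ℕ) + l) ≠ 1 := by
      intro h1
      have h2 := (hp.pow_eq_one_iff_dvd _).1 h1
      obtain ⟨c, hc⟩ := h2
      have hj := j.2
      have hl := l.2
      have hjl : (j : ℕ) ≠ l := fun h' => h (Fin.ext h')
      have : c = 1 := by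
        rcases c with _ | _ | c
        · omega
        · rfl
        · exfalso
          have : d * (c + 1 + 1) = d * c + 2 * d := by ring
          have : 0 ≤ d * c := Nat.zero_le _
          omega
      subst this
      omega
    have h3 := mul_geom_sum (om d ^ (d - (j : ℕ) + l)) d
    rw [← pow_mul, mul_comm _ d, pow_mul, hp.pow_eq_one, one_pow, sub_self] at h3
    exact (mul_eq_zero.1 h3).resolve_left (sub_ne_zero.2 hne)

lemma sum_ne_zero_filter (d : ℕ) [NeZero d] (f : Fin d → ℂ) :
    ∑ k ∈ Finset.univ.filter (fun k : Fin d => (k : ℕ) ≠ 0), f k = ∑ k, f k - f 0 := by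
  have : Finset.univ.filter (fun k : Fin d => (k : ℕ) ≠ 0) = Finset.univ.erase 0 := by
    ext k
    simp
  rw [this, eq_sub_iff_add_eq, Finset.sum_erase_add _ _ (Finset.mem_univ _)]

/-- the sum of ratios -/
def ratS (d : ℕ) (α : Fin d → ℝ) : ℝ :=
  ∑ i : Fin d, ∑ j : Fin d, if i ≠ j then α i / α j else 0

lemma ratS_pos (d : ℕ) (hd : 2 ≤ d) (α : Fin d → ℝ) (hpos : ∀ i, 0 < α i) : 0 < ratS d α := by
  have hn : ∀ i j : Fin d, 0 ≤ (if i ≠ j then α i / α j else 0) := by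
    intro i j
    have := hpos i
    have := hpos j
    split_ifs <;> positivity
  have h0 : 0 < d := by omega
  refine Finset.sum_pos' (fun i _ => Finset.sum_nonneg fun j _ => hn i j)
    ⟨⟨0, h0⟩, Finset.mem_univ _, ?_⟩
  refine Finset.sum_pos' (fun j _ => hn _ j) ⟨⟨1, hd⟩, Finset.mem_univ _, ?_⟩
  rw [if_pos (by simp)]
  exact div_pos (hpos _) (hpos _)

lemma delt_sum (d : ℕ) [NeZero d] (hd : 2 ≤ d) (α : Fin d → ℝ) (hpos : ∀ i, 0 < α i)
    (l : Fin d) :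
    ∑ k ∈ Finset.univ.filter (fun k : Fin d => (k : ℕ) ≠ 0), delt d α k * om d ^ ((l : ℕ) * k)
      = ((1 - gam d α * ∑ i, (if i ≠ l then α i / α l else 0) : ℝ) : ℂ) := by
  have hd0 : (d : ℂ) ≠ 0 := by
    have : d ≠ 0 := by omega
    exact_mod_cast this
  have hS := (ratS_pos d hd α hpos).ne'
  have hgS : gam d α * ratS d α = d := div_mul_cancel₀ _ hS
  have hgS' : (gam d α : ℂ) * (ratS d α : ℂ) = d := by exact_mod_cast hgS
  rw [sum_ne_zero_filter]
  have h0 : delt d α ((0 : Fin d) : ℕ) * om d ^ ((l : ℕ) * ((0 : Fin d) : ℕ)) = -1 := by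
    have : ∑ i : Fin d, ∑ j : Fin d,
        (if i ≠ j then ((α i / α j : ℝ) : ℂ) * om d ^ (0 * (d - (j : ℕ))) else 0)
        = (ratS d α : ℂ) := by
      simp only [ratS, Complex.ofReal_sum, zero_mul, pow_zero, mul_one]
      refine Finset.sum_congr rfl fun i _ => Finset.sum_congr rfl fun j _ => ?_
      split_ifs <;> simp
    simp only [Fin.val_zero, delt, this, mul_zero, pow_zero, mul_one]
    rw [neg_mul, div_mul_eq_mul_div, hgS', div_self hd0]
  have h1 : ∑ k : Fin d, delt d α k * om d ^ ((l : ℕ) * k)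
      = -((gam d α : ℂ) / d) * (d * ∑ i, (if i ≠ l then ((α i / α l : ℝ) : ℂ) else 0)) := by
    simp only [delt, mul_assoc, ← Finset.mul_sum]
    congr 1
    simp only [Finset.sum_mul, Finset.mul_sum]
    rw [Finset.sum_comm]
    refine Finset.sum_congr rfl fun i _ => ?_
    rw [Finset.sum_comm]
    have : ∀ j : Fin d, ∑ k : Fin d, (if i ≠ j then ((α i / α j : ℝ) : ℂ) *
        om d ^ ((k : ℕ) * (d - (j : ℕ))) else 0) * om d ^ ((l : ℕ) * k)
        = (if i ≠ j then ((α i / α j : ℝ) : ℂ) else 0) * (if j = l then (d : ℂ) else 0) := by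
      intro j
      rw [← root_sum d hd l j, Finset.mul_sum]
      refine Finset.sum_congr rfl fun k _ => ?_
      split_ifs <;> ring
    simp_rw [this]
    simp only [mul_ite, mul_zero, Finset.sum_ite_eq', Finset.mem_univ, if_true]
    split_ifs <;> ring
  rw [h0, h1]
  have h2 : ((∑ i, (if i ≠ l then α i / α l else 0) : ℝ) : ℂ)
      = ∑ i, (if i ≠ l then ((α i / α l : ℝ) : ℂ) else 0) := by
    rw [Complex.ofReal_sum]
    refine Finset.sum_congr rfl fun i _ => ?_
    split_ifs <;> simp
  rw [Complex.ofReal_sub, Complex.ofReal_mul, h2]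
  field_simp
  push_cast
  ring

lemma x_bound (d n : ℕ) [NeZero d] (α : Fin d → ℝ) (hpos : ∀ i, 0 < α i)
    (B : Fin d → Matrix (Fin n) (Fin n) ℂ)
    (hB : ∀ k : Fin d, ((1 : Matrix (Fin n) (Fin n) ℂ) - (B k)ᴴ * B k).PosSemidef)
    (v : Fin d → Fin n → ℂ) :
    (∑ k ∈ Finset.univ.filter (fun k : Fin d => (k : ℕ) ≠ 0),
      ∑ i, ∑ j, (Xd d ^ (k : ℕ)) i j * (star (v i) ⬝ᵥ B k *ᵥ v j)).re
    ≤ ∑ j, (∑ i, (if i ≠ j then α i / α j else 0)) * nsq (v j) := by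
  have hX : ∀ k i j : Fin d, (Xd d ^ (k : ℕ)) i j = if k = i - j then 1 else 0 := by
    intro k i j
    rw [Xd_pow]
    refine if_congr ?_ rfl rfl
    rw [eq_sub_iff_add_eq, Fin.ext_iff, Fin.val_add, add_comm (k : ℕ), eq_comm]
  have e : ∑ k ∈ Finset.univ.filter (fun k : Fin d => (k : ℕ) ≠ 0),
      ∑ i, ∑ j, (Xd d ^ (k : ℕ)) i j * (star (v i) ⬝ᵥ B k *ᵥ v j)
      = ∑ i, ∑ j, if i ≠ j then (star (v i) ⬝ᵥ B (i - j) *ᵥ v j) else 0 := by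
    rw [Finset.sum_comm]
    refine Finset.sum_congr rfl fun i _ => ?_
    rw [Finset.sum_comm]
    refine Finset.sum_congr rfl fun j _ => ?_
    simp only [hX, ite_mul, one_mul, zero_mul, Finset.sum_ite_eq', Finset.mem_filter,
      Finset.mem_univ, true_and]
    refine if_congr ?_ rfl rfl
    rw [Ne, Fin.val_eq_zero_iff, sub_eq_zero]
  rw [e]
  have hb : ∀ i j, (if i ≠ j then (star (v i) ⬝ᵥ B (i - j) *ᵥ v j) else 0).re
      ≤ ((if i ≠ j then α i / α j else 0) * nsq (v j)
        + (if j ≠ i then α j / α i else 0) * nsq (v i)) / 2 := by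
    intro i j
    by_cases h : i = j
    · simp [h]
    · rw [if_pos h, if_pos h, if_pos (Ne.symm h)]
      have := re_dot_le (B (i - j)) (hB _) (v i) (v j) 1 (by simp) (α i / α j)
        (div_pos (hpos i) (hpos j))
      rwa [one_mul, inv_div] at this
  simp only [Complex.re_sum]
  refine (Finset.sum_le_sum fun i _ => Finset.sum_le_sum fun j _ => hb i j).trans (le_of_eq ?_)
  simp only [← Finset.sum_div, Finset.sum_add_distrib, Finset.sum_mul]
  rw [Finset.sum_comm]
  ring

/-- for any Fourier families `B_{k|0}`, `B_{k|1}` on `ℂ^n` and any unit vector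
`ψ ∈ ℂ^d ⊗ ℂ^n`, the steering operator satisfies `Re⟨ψ, B̂_d(α) ψ⟩ ≤ d`. -/
theorem steering_quantum_bound (d n : ℕ) [NeZero d] (hd : 2 ≤ d)
    (α : Fin d → ℝ) (hpos : ∀ i, 0 < α i) (hnorm : ∑ i, α i ^ 2 = 1)
    (B0 B1 : Fin d → Matrix (Fin n) (Fin n) ℂ)
    (hB0 : IsFourierFamily d n B0) (hB1 : IsFourierFamily d n B1)
    (ψ : Fin d × Fin n → ℂ) (hψ : ∑ p, Complex.normSq (ψ p) = 1) :
    (star ψ ⬝ᵥ (steerOp d n α B0 B1).mulVec ψ).re ≤ d := by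
  obtain ⟨-, hC0, -⟩ := hB0
  obtain ⟨-, hC1, -⟩ := hB1
  have hd0 : d ≠ 0 := by omega
  set v : Fin d → Fin n → ℂ := fun i m => ψ (i, m) with hv
  have hN : ∑ l, nsq (v l) = 1 := by
    rw [← hψ, Fintype.sum_prod_type]
    rfl
  have hg : 0 ≤ gam d α := div_nonneg (Nat.cast_nonneg _) (ratS_pos d hd α hpos).le
  have hZ : ∀ (k : Fin d) (B : Matrix (Fin n) (Fin n) ℂ),
      star ψ ⬝ᵥ ((Zd d ^ (k : ℕ)) ⊗ₖ B) *ᵥ ψ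
        = ∑ l : Fin d, om d ^ ((l : ℕ) * k) * (star (v l) ⬝ᵥ B *ᵥ v l) := by
    intro k B
    rw [quad_kron, Zd_pow]
    refine Finset.sum_congr rfl fun i _ => ?_
    simp [Matrix.diagonal_apply, hv]
  have main : star ψ ⬝ᵥ (steerOp d n α B0 B1) *ᵥ ψ =
      ∑ k ∈ Finset.univ.filter (fun k : Fin d => (k : ℕ) ≠ 0),
        ∑ l : Fin d, om d ^ ((l : ℕ) * k) * (star (v l) ⬝ᵥ B0 k *ᵥ v l)
      + (gam d α : ℂ) * ∑ k ∈ Finset.univ.filter (fun k : Fin d => (k : ℕ) ≠ 0),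
        ∑ i, ∑ j, (Xd d ^ (k : ℕ)) i j * (star (v i) ⬝ᵥ B1 k *ᵥ v j)
      + ∑ l, ((1 - gam d α * ∑ i, (if i ≠ l then α i / α l else 0) : ℝ) : ℂ) * nsq (v l) := by
    simp_rw [← delt_sum d hd α hpos, Finset.sum_mul]
    rw [Finset.sum_comm (s := Finset.univ), Finset.mul_sum, ← Finset.sum_add_distrib,
      ← Finset.sum_add_distrib, steerOp, Matrix.sum_mulVec, dotProduct_sum]
    refine Finset.sum_congr rfl fun k _ => ?_
    rw [add_mulVec, add_mulVec, dotProduct_add, dotProduct_add, smul_mulVec, smul_mulVec,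
      dotProduct_smul, dotProduct_smul, hZ, hZ, quad_kron, smul_eq_mul, smul_eq_mul]
    congr 1
    rw [Finset.mul_sum]
    refine Finset.sum_congr rfl fun l _ => ?_
    rw [one_mulVec, dot_self]
    ring
  rw [main, Complex.add_re, Complex.add_re, Complex.re_ofReal_mul]
  have b1 : (∑ k ∈ Finset.univ.filter (fun k : Fin d => (k : ℕ) ≠ 0),
        ∑ l : Fin d, om d ^ ((l : ℕ) * k) * (star (v l) ⬝ᵥ B0 k *ᵥ v l)).re ≤ d - 1 := by
    rw [Complex.re_sum]
    have hk : ∀ k : Fin d, (∑ l : Fin d, om d ^ ((l : ℕ) * k) * (star (v l) ⬝ᵥ B0 k *ᵥ v l)).re ≤ 1 := by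
      intro k
      rw [Complex.re_sum, ← hN]
      refine Finset.sum_le_sum fun l _ => ?_
      have := re_dot_le (B0 k) (hC0 k) (v l) (v l) _ (normSq_om d hd0 ((l : ℕ) * k)) 1 one_pos
      linarith
    refine (Finset.sum_le_sum fun k _ => hk k).trans (le_of_eq ?_)
    have h1 := sum_ne_zero_filter d (fun _ => 1)
    simp only [Finset.sum_const, Finset.card_univ, Fintype.card_fin, nsmul_eq_mul, mul_one] at h1 ⊢
    exact_mod_cast h1
  have b2 := mul_le_mul_of_nonneg_left (x_bound d n α hpos B1 hC1 v) hg
  have b3 : (∑ l, ((1 - gam d α * ∑ i, (if i ≠ l then α i / α l else 0) : ℝ) : ℂ)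
      * nsq (v l)).re
      = 1 - gam d α * ∑ j, (∑ i, (if i ≠ j then α i / α j else 0)) * nsq (v j) := by
    rw [Complex.re_sum, ← hN, Finset.mul_sum, ← Finset.sum_sub_distrib]
    refine Finset.sum_congr rfl fun l _ => ?_
    rw [← Complex.ofReal_mul, Complex.ofReal_re, hN, sub_mul, one_mul, mul_assoc]
  rw [b3]
  linarith
end
end

section
/- Take n = d, B_{k|0} = (conj(Z_d))^k (entrywise complex conjugate of Z_d, raised to the k-th power) and B_{k|1} = X_d^k, which form Fourier families on ℂ^d, and let B̂_d(α) = ∑_{k=1}^{d-1} ( Z_d^k ⊗ B_{k|0} + γ(α)·X_d^k ⊗ B_{k|1} + δ_k(α)·Z_d^k ⊗ 𝟙_d ). Then ⟨ψ(α), B̂_d(α) ψ(α)⟩ = d, i.e. the value d is attained by the pure entangled state |ψ(α)⟩ with Bob's observables Z_d* and X_d. -/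
open Matrix Kronecker Finset
open scoped ComplexOrder

noncomputable section

theorem aux_om_pow (d : ℕ) [NeZero d] : om d ^ d = 1 :=
  (Complex.isPrimitiveRoot_exp d (NeZero.ne d)).pow_eq_one

theorem aux_om_conj (d : ℕ) [NeZero d] : starRingEnd ℂ (om d) * om d = 1 := by
  have h : ‖om d‖ = 1 :=
    (Complex.isPrimitiveRoot_exp d (NeZero.ne d)).norm'_eq_one (NeZero.ne d)
  rw [mul_comm, Complex.mul_conj, Complex.normSq_eq_norm_sq, h]; simp

theorem aux_X_pow (d : ℕ) [NeZero d] (k : ℕ) (i j : Fin d) :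
    (Xd d ^ k) i j = if (i : ℕ) = ((j : ℕ) + k) % d then 1 else 0 := by
  induction k generalizing i j with
  | zero =>
    simp [Matrix.one_apply, Nat.mod_eq_of_lt j.2, Fin.ext_iff]
  | succ k ih =>
    rw [pow_succ, Matrix.mul_apply,
      Finset.sum_eq_single (⟨((j : ℕ) + 1) % d, Nat.mod_lt _ (NeZero.pos d)⟩ : Fin d)]
    · rw [ih]
      simp [Xd, Nat.add_assoc, Nat.add_comm 1 k]
    · intro b _ hb
      have : ¬ (b : ℕ) = ((j : ℕ) + 1) % d := fun h => hb (Fin.ext h)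
      simp [Xd, this]
    · simp

theorem aux_X_d (d : ℕ) [NeZero d] : Xd d ^ d = 1 := by
  ext i j
  rw [aux_X_pow]
  simp [Matrix.one_apply, Nat.mod_eq_of_lt j.2, Fin.ext_iff]

theorem aux_mod_inj (d : ℕ) (i j : Fin d) (h : ((i : ℕ) + 1) % d = ((j : ℕ) + 1) % d) :
    i = j := by
  have : (i : ℕ) ≡ j [MOD d] := Nat.ModEq.add_right_cancel' 1 h
  exact Fin.ext (Nat.ModEq.eq_of_lt_of_lt this i.2 j.2)

theorem aux_X_unit (d : ℕ) [NeZero d] : (Xd d)ᴴ * Xd d = 1 := by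
  ext i j
  rw [Matrix.mul_apply,
    Finset.sum_eq_single (⟨((j : ℕ) + 1) % d, Nat.mod_lt _ (NeZero.pos d)⟩ : Fin d)]
  · by_cases h : i = j
    · subst h; simp [Xd]
    · have : ¬ ((j : ℕ) + 1) % d = ((i : ℕ) + 1) % d := fun h' => h (aux_mod_inj d j i h').symm
      simp [Xd, this, h]
  · intro b _ hb
    have : ¬ (b : ℕ) = ((j : ℕ) + 1) % d := fun h => hb (Fin.ext h)
    simp [Xd, this]
  · simp

theorem aux_fourier (d : ℕ) [NeZero d] (U : Matrix (Fin d) (Fin d) ℂ) (hU : Uᴴ * U = 1)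
    (hd : U ^ d = 1) (B : Fin d → Matrix (Fin d) (Fin d) ℂ) (hB : ∀ k, B k = U ^ (k : ℕ)) :
    IsFourierFamily d d B := by
  have hk : ∀ n : ℕ, (U ^ n)ᴴ * U ^ n = 1 := by
    intro n
    induction n with
    | zero => simp
    | succ n ih =>
      rw [pow_succ, Matrix.conjTranspose_mul, Matrix.mul_assoc, ← Matrix.mul_assoc _ (U ^ n) U,
        ih, Matrix.one_mul, hU]
  refine ⟨fun k h => by rw [hB, h, pow_zero], fun k => ?_, fun k => ?_⟩
  · rw [hB, hk, sub_self]; exact Matrix.PosSemidef.zero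
  · have h1 : B (-k) * B k = 1 := by
      rw [hB, hB, ← pow_add]
      by_cases h0 : k = 0
      · subst h0; simp
      · have hv : (k : ℕ) ≠ 0 := fun h => h0 (Fin.ext (by simpa using h))
        have : ((-k : Fin d) : ℕ) + (k : ℕ) = d := by
          have := k.2
          rw [Fin.val_neg', Nat.mod_eq_of_lt (by omega)]; omega
        rw [this, hd]
    have h2 : B k * (B k)ᴴ = 1 := by
      rw [hB]; exact mul_eq_one_comm.mp (hk _)
    calc B (-k) = B (-k) * (B k * (B k)ᴴ) := by rw [h2, mul_one]
      _ = (B k)ᴴ := by rw [← mul_assoc, h1, one_mul]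

theorem aux_exp (d : ℕ) (α : Fin d → ℝ) (ψ : Fin d × Fin d → ℂ)
    (hψ : ∀ p : Fin d × Fin d, ψ p = if p.1 = p.2 then (α p.1 : ℂ) else 0)
    (A B : Matrix (Fin d) (Fin d) ℂ) :
    star ψ ⬝ᵥ (A ⊗ₖ B).mulVec ψ = ∑ i, ∑ j, (α i : ℂ) * α j * A i j * B i j := by
  simp only [dotProduct, Matrix.mulVec, Fintype.sum_prod_type, Pi.star_apply, hψ,
    Matrix.kroneckerMap_apply]
  refine Finset.sum_congr rfl fun i _ => ?_
  rw [Finset.sum_eq_single i]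
  · simp only [if_true, Finset.mul_sum]
    refine Finset.sum_congr rfl fun j _ => ?_
    rw [Finset.sum_eq_single j]
    · simp; ring
    · intro b _ hb; simp [hb.symm]
    · simp
  · intro b _ hb; simp [hb.symm]
  · simp

theorem aux_Zmap (d : ℕ) : (Zd d).map (starRingEnd ℂ) =
    Matrix.diagonal fun i : Fin d => (starRingEnd ℂ (om d)) ^ (i : ℕ) := by
  rw [Zd, Matrix.diagonal_map (by simp)]
  congr 1; ext i; simp

/-- character sum over nonzero `k` -/
theorem aux_char (d : ℕ) [NeZero d] (l j : Fin d) :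
    ∑ k ∈ Finset.univ.filter (fun k : Fin d => (k : ℕ) ≠ 0),
      om d ^ ((k : ℕ) * (d - (j : ℕ))) * (om d ^ (l : ℕ)) ^ (k : ℕ)
      = (if l = j then (d : ℂ) else 0) - 1 := by
  have hp : IsPrimitiveRoot (om d) d := Complex.isPrimitiveRoot_exp d (NeZero.ne d)
  set z := om d ^ (d - (j : ℕ) + l) with hz
  have e : ∀ k : Fin d, om d ^ ((k : ℕ) * (d - (j : ℕ))) * (om d ^ (l : ℕ)) ^ (k : ℕ)
      = z ^ (k : ℕ) := by
    intro k; rw [hz, ← pow_mul, ← pow_mul, ← pow_add]; congr 1; ring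
  have hzd : z ^ d = 1 := by rw [hz, ← pow_mul, mul_comm, pow_mul, aux_om_pow, one_pow]
  have hf : ∑ k : Fin d, z ^ (k : ℕ) = if l = j then (d : ℂ) else 0 := by
    rw [Fin.sum_univ_eq_sum_range (fun k => z ^ k)]
    split_ifs with h
    · have : z = 1 := by
        rw [hz, h, Nat.sub_add_cancel j.2.le, aux_om_pow]
      simp [this]
    · have hz1 : z ≠ 1 := by
        intro h1
        rw [hz, hp.pow_eq_one_iff_dvd] at h1
        apply h
        have hj := j.2
        have hl := l.2
        obtain ⟨c, hc⟩ := h1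
        have : c = 1 := by
          have h2 : 0 < c := by
            rcases Nat.eq_zero_or_pos c with h | h
            · subst h; omega
            · exact h
          have h3 : c < 2 := by
            by_contra h4
            have : d * 2 ≤ d * c := Nat.mul_le_mul_left d (by omega)
            omega
          omega
        subst this
        exact Fin.ext (by omega)
      have := mul_geom_sum z d
      rw [hzd, sub_self] at this
      exact (mul_eq_zero.mp this).resolve_left (sub_ne_zero.mpr hz1)
  rw [Finset.sum_congr rfl fun k _ => e k, ← hf,
    ← Finset.sum_filter_add_sum_filter_not Finset.univ (fun k : Fin d => (k : ℕ) ≠ 0)]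
  have : (Finset.univ.filter (fun k : Fin d => ¬ (k : ℕ) ≠ 0)) = {0} := by
    ext k; simp
  rw [this]; simp

theorem aux_X_sum (d : ℕ) [NeZero d] (i j : Fin d) :
    ∑ k ∈ Finset.univ.filter (fun k : Fin d => (k : ℕ) ≠ 0),
      (Xd d ^ (k : ℕ)) i j * (Xd d ^ (k : ℕ)) i j = if i ≠ j then (1 : ℂ) else 0 := by
  have e : ∀ k : Fin d, (Xd d ^ (k : ℕ)) i j * (Xd d ^ (k : ℕ)) i j
      = if k = i - j then (1 : ℂ) else 0 := by
    intro k
    have : ((i : ℕ) = ((j : ℕ) + k) % d) ↔ k = i - j := by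
      rw [← Fin.val_add, ← Fin.ext_iff, eq_sub_iff_add_eq, add_comm, eq_comm]
    rw [aux_X_pow]; simp [this]
  rw [Finset.sum_congr rfl fun k _ => e k, Finset.sum_ite_eq']
  simp [sub_eq_zero]

/-- with `B_{k|0} = (conj Z_d)^k` and `B_{k|1} = X_d^k` (Fourier families on `ℂ^d`),
the state `|ψ(α)⟩ = ∑_i α_i|ii⟩` attains the value `d`: `⟨ψ(α), B̂_d(α) ψ(α)⟩ = d`. -/
theorem steering_value_attained (d : ℕ) [NeZero d] (hd : 2 ≤ d)
    (α : Fin d → ℝ) (hpos : ∀ i, 0 < α i) (hnorm : ∑ i, α i ^ 2 = 1)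
    (B0 B1 : Fin d → Matrix (Fin d) (Fin d) ℂ)
    (hB0 : ∀ k : Fin d, B0 k = ((Zd d).map (starRingEnd ℂ)) ^ (k : ℕ))
    (hB1 : ∀ k : Fin d, B1 k = Xd d ^ (k : ℕ))
    (ψα : Fin d × Fin d → ℂ)
    (hψα : ∀ p : Fin d × Fin d, ψα p = if p.1 = p.2 then (α p.1 : ℂ) else 0) :
    IsFourierFamily d d B0 ∧ IsFourierFamily d d B1 ∧
      star ψα ⬝ᵥ (steerOp d d α B0 B1).mulVec ψα = (d : ℂ) := by
  have hne : (d : ℂ) ≠ 0 := Nat.cast_ne_zero.mpr (NeZero.ne d)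
  refine ⟨aux_fourier d _ ?_ ?_ B0 hB0, aux_fourier d _ (aux_X_unit d) (aux_X_d d) B1 hB1, ?_⟩
  · rw [aux_Zmap, Matrix.diagonal_conjTranspose, Matrix.diagonal_mul_diagonal,
      ← Matrix.diagonal_one]
    congr 1; ext i
    simp only [Pi.star_apply, star_pow, ← mul_pow]
    rw [← starRingEnd_apply, mul_comm, starRingEnd_self_apply, aux_om_conj, one_pow]
  · rw [aux_Zmap, Matrix.diagonal_pow, ← Matrix.diagonal_one]
    congr 1; ext i
    simp only [Pi.pow_apply]
    rw [← pow_mul, mul_comm, pow_mul, ← map_pow, aux_om_pow, map_one, one_pow]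
  set F := Finset.univ.filter (fun k : Fin d => (k : ℕ) ≠ 0) with hF
  have hcard : ((F.card : ℕ) : ℂ) = d - 1 := by
    have h := aux_char d 0 0
    rw [← hF, if_pos rfl] at h
    rw [← h]
    simp [aux_om_pow, pow_mul, mul_comm _ d]
  have hα1 : ∑ i, (α i : ℂ) * α i = 1 := by
    rw [← Complex.ofReal_one, ← hnorm]; push_cast
    exact Finset.sum_congr rfl fun i _ => by ring
  have hZ : ∀ k : ℕ, Zd d ^ k = Matrix.diagonal fun i : Fin d => (om d ^ (i : ℕ)) ^ k := by
    intro k; rw [Zd, Matrix.diagonal_pow]; rfl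
  have t1 : ∀ k : Fin d, star ψα ⬝ᵥ ((Zd d ^ (k : ℕ)) ⊗ₖ B0 k).mulVec ψα = 1 := by
    intro k
    rw [aux_exp d α ψα hψα, ← hα1]
    refine Finset.sum_congr rfl fun i _ => ?_
    rw [Finset.sum_eq_single i]
    · rw [hB0, aux_Zmap, hZ, Matrix.diagonal_pow, Matrix.diagonal_apply_eq,
        Matrix.diagonal_apply_eq, Pi.pow_apply, mul_assoc, ← mul_pow, ← mul_pow,
        mul_comm (om d), aux_om_conj, one_pow, one_pow, mul_one]
    · intro b _ hb
      rw [hZ, Matrix.diagonal_apply_ne _ hb.symm]; simp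
    · simp
  have t3 : ∀ k : Fin d, star ψα ⬝ᵥ
      ((Zd d ^ (k : ℕ)) ⊗ₖ (1 : Matrix (Fin d) (Fin d) ℂ)).mulVec ψα
      = ∑ l, (α l : ℂ) * α l * (om d ^ (l : ℕ)) ^ (k : ℕ) := by
    intro k
    rw [aux_exp d α ψα hψα]
    refine Finset.sum_congr rfl fun i _ => ?_
    rw [Finset.sum_eq_single i]
    · rw [hZ]; simp
    · intro b _ hb
      rw [hZ, Matrix.diagonal_apply_ne _ hb.symm]; simp
    · simp
  have t2 : ∑ k ∈ F, star ψα ⬝ᵥ ((Xd d ^ (k : ℕ)) ⊗ₖ B1 k).mulVec ψα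
      = ∑ i, ∑ j, if i ≠ j then (α i : ℂ) * α j else 0 := by
    simp only [aux_exp d α ψα hψα, hB1]
    rw [Finset.sum_comm]
    refine Finset.sum_congr rfl fun i _ => ?_
    rw [Finset.sum_comm]
    refine Finset.sum_congr rfl fun j _ => ?_
    simp only [mul_assoc]
    rw [← Finset.mul_sum, ← Finset.mul_sum, aux_X_sum]
    simp
  set S : ℝ := ∑ i : Fin d, ∑ j : Fin d, if i ≠ j then α i / α j else 0 with hS
  have hSpos : 0 < S := by
    have hnn : ∀ i j : Fin d, 0 ≤ if i ≠ j then α i / α j else 0 := by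
      intro i j
      split_ifs
      · exact (div_pos (hpos i) (hpos j)).le
      · exact le_rfl
    have h01 : (⟨0, by omega⟩ : Fin d) ≠ ⟨1, by omega⟩ := by simp [Fin.ext_iff]
    refine Finset.sum_pos' (fun i _ => Finset.sum_nonneg fun j _ => hnn i j)
      ⟨⟨0, by omega⟩, Finset.mem_univ _, Finset.sum_pos' (fun j _ => hnn _ j)
        ⟨⟨1, by omega⟩, Finset.mem_univ _, ?_⟩⟩
    rw [if_pos h01]
    exact div_pos (hpos _) (hpos _)
  have hγ : ((gam d α : ℝ) : ℂ) * S = d := by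
    rw [← Complex.ofReal_mul, gam, ← hS, div_mul_cancel₀ _ hSpos.ne']; simp
  have hSc : (S : ℂ) = ∑ i : Fin d, ∑ j : Fin d,
      if i ≠ j then ((α i / α j : ℝ) : ℂ) else 0 := by
    rw [hS]; push_cast
    refine Finset.sum_congr rfl fun i _ => Finset.sum_congr rfl fun j _ => ?_
    split_ifs <;> simp
  have inner : ∀ j : Fin d, ∑ k ∈ F, om d ^ ((k : ℕ) * (d - (j : ℕ))) *
      ∑ l, (α l : ℂ) * α l * (om d ^ (l : ℕ)) ^ (k : ℕ) = d * (α j * α j) - 1 := by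
    intro j
    simp only [Finset.mul_sum]
    rw [Finset.sum_comm]
    have : ∀ l : Fin d, ∑ k ∈ F, om d ^ ((k : ℕ) * (d - (j : ℕ))) *
        ((α l : ℂ) * α l * (om d ^ (l : ℕ)) ^ (k : ℕ))
        = (α l : ℂ) * α l * ((if l = j then (d : ℂ) else 0) - 1) := by
      intro l
      rw [← aux_char d l j, Finset.mul_sum]
      exact Finset.sum_congr rfl fun k _ => by ring
    rw [Finset.sum_congr rfl fun l _ => this l]
    simp only [mul_sub, mul_one, Finset.sum_sub_distrib, hα1]
    simp [mul_comm]
  have t3' : ∑ k ∈ F, delt d α (k : ℕ) * ∑ l, (α l : ℂ) * α l * (om d ^ (l : ℕ)) ^ (k : ℕ)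
      = -(((gam d α : ℝ) : ℂ) / d) *
        (d * (∑ i, ∑ j, if i ≠ j then (α i : ℂ) * α j else 0) - S) := by
    simp only [delt, mul_assoc]
    rw [← Finset.mul_sum]
    congr 1
    simp only [Finset.sum_mul]
    rw [Finset.sum_comm, hSc, Finset.mul_sum, ← Finset.sum_sub_distrib]
    refine Finset.sum_congr rfl fun i _ => ?_
    rw [Finset.sum_comm, Finset.mul_sum, ← Finset.sum_sub_distrib]
    refine Finset.sum_congr rfl fun j _ => ?_
    by_cases h : i = j
    · simp [h]
    · simp only [ne_eq, h, not_false_eq_true, if_true, mul_assoc]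
      rw [← Finset.mul_sum]
      have := inner j
      simp only [mul_assoc] at this
      rw [this]
      have hj : (α j : ℂ) ≠ 0 := Complex.ofReal_ne_zero.mpr (hpos j).ne'
      push_cast
      field_simp
  have main : star ψα ⬝ᵥ (steerOp d d α B0 B1).mulVec ψα =
      ∑ k ∈ F, star ψα ⬝ᵥ ((Zd d ^ (k : ℕ)) ⊗ₖ B0 k).mulVec ψα
      + ((gam d α : ℝ) : ℂ) * ∑ k ∈ F, star ψα ⬝ᵥ ((Xd d ^ (k : ℕ)) ⊗ₖ B1 k).mulVec ψα
      + ∑ k ∈ F, delt d α (k : ℕ) * (star ψα ⬝ᵥ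
        ((Zd d ^ (k : ℕ)) ⊗ₖ (1 : Matrix (Fin d) (Fin d) ℂ)).mulVec ψα) := by
    rw [steerOp, Matrix.sum_mulVec, dotProduct_sum, Finset.mul_sum, ← Finset.sum_add_distrib,
      ← Finset.sum_add_distrib]
    refine Finset.sum_congr rfl fun k _ => ?_
    simp only [Matrix.add_mulVec, Matrix.smul_mulVec, dotProduct_add, dotProduct_smul,
      smul_eq_mul]
  rw [main, t2, Finset.sum_congr rfl fun k _ => t1 k]
  simp only [t3]
  rw [t3', Finset.sum_const, nsmul_eq_mul, mul_one, hcard]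
  generalize (∑ i, ∑ j, if i ≠ j then (α i : ℂ) * α j else 0) = T
  field_simp
  linear_combination hγ
end
end

section
/- For every tuple of nonnegative reals (t_0,…,t_{d-1}) with ∑_i t_i² = 1, one has d·max_a t_a² + γ(α)·( (∑_i t_i)² − (∑_i α_i)·(∑_a t_a²/α_a) ) < d. (This is the key estimate showing that the classical/LHS bound β_L(α) of the steering inequality is strictly smaller than its quantum value d, i.e. the inequality is nontrivial for every α with all α_i > 0.) -/
open Matrix Kronecker Finset
open scoped ComplexOrder

noncomputable section

/-- the key estimate for the classical (LHS) bound: for every tuple of nonnegative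
reals `t` with `∑ tᵢ² = 1`,
`d·max_a t_a² + γ(α)·((∑ tᵢ)² − (∑ αᵢ)·(∑ t_a²/α_a)) < d`. -/
theorem classical_bound_strict (d : ℕ) (hd : 2 ≤ d)
    (α : Fin d → ℝ) (hpos : ∀ i, 0 < α i) (hnorm : ∑ i, α i ^ 2 = 1)
    (t : Fin d → ℝ) (ht : ∀ i, 0 ≤ t i) (htnorm : ∑ i, t i ^ 2 = 1) :
    (d : ℝ) * (Finset.univ.sup' ⟨⟨0, by omega⟩, Finset.mem_univ _⟩ fun a => t a ^ 2)
      + gam d α * ((∑ i, t i) ^ 2 - (∑ i, α i) * (∑ a, t a ^ 2 / α a)) < d := by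
  have hd0 : (0 : ℝ) < d := by exact_mod_cast (by omega : 0 < d)
  have hS : 0 < ∑ i : Fin d, ∑ j : Fin d, if i ≠ j then α i / α j else 0 := by
    have hnn : ∀ i j : Fin d, 0 ≤ if i ≠ j then α i / α j else 0 := by
      intro i j
      split_ifs
      · exact (div_pos (hpos i) (hpos j)).le
      · exact le_rfl
    refine Finset.sum_pos' (fun i _ => Finset.sum_nonneg fun j _ => hnn i j)
      ⟨⟨0, by omega⟩, Finset.mem_univ _, ?_⟩
    refine Finset.sum_pos' (fun j _ => hnn _ j) ⟨⟨1, by omega⟩, Finset.mem_univ _, ?_⟩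
    rw [if_pos (by simp)]
    exact div_pos (hpos _) (hpos _)
  have hg : 0 < gam d α := div_pos hd0 hS
  have hcs : (∑ i, t i) ^ 2 ≤ (∑ i, α i) * (∑ a, t a ^ 2 / α a) := by
    refine Finset.sum_sq_le_sum_mul_sum_of_sq_eq_mul _ (fun i _ => (hpos i).le)
      (fun i _ => div_nonneg (sq_nonneg _) (hpos i).le) (fun i _ => ?_)
    have := (hpos i).ne'
    field_simp
  obtain ⟨a, -, ha⟩ := Finset.exists_mem_eq_sup' (s := (Finset.univ : Finset (Fin d)))
    ⟨⟨0, by omega⟩, Finset.mem_univ _⟩ (fun a => t a ^ 2)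
  rw [ha]
  have hle : t a ^ 2 ≤ 1 := by
    rw [← htnorm]
    exact Finset.single_le_sum (f := fun i => t i ^ 2) (fun i _ => sq_nonneg _)
      (Finset.mem_univ a)
  rcases hle.lt_or_eq with hlt | heq
  · have h1 : (d : ℝ) * t a ^ 2 < d := by nlinarith
    have h2 := mul_nonpos_of_nonneg_of_nonpos hg.le (sub_nonpos.2 hcs)
    linarith
  · have hz : ∀ b, b ≠ a → t b = 0 := by
      have h0 : ∑ i ∈ Finset.univ.erase a, t i ^ 2 = 0 := by
        have := Finset.add_sum_erase Finset.univ (fun i => t i ^ 2) (Finset.mem_univ a)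
        linarith
      intro b hb
      have := (Finset.sum_eq_zero_iff_of_nonneg (fun i _ => sq_nonneg (t i))).1 h0 b
        (Finset.mem_erase.2 ⟨hb, Finset.mem_univ _⟩)
      exact pow_eq_zero_iff (two_ne_zero) |>.1 this
    have e1 : ∑ i, t i = t a := Finset.sum_eq_single a (fun b _ hb => hz b hb) (by simp)
    have e2 : ∑ i, t i ^ 2 / α i = t a ^ 2 / α a :=
      Finset.sum_eq_single a (fun b _ hb => by simp [hz b hb]) (by simp)
    have hlt : α a < ∑ i, α i := by
      have : ∃ b : Fin d, b ≠ a := by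
        have : Nontrivial (Fin d) := Fin.nontrivial_iff_two_le.2 hd
        exact exists_ne a
      obtain ⟨b, hb⟩ := this
      exact Finset.single_lt_sum hb (Finset.mem_univ a) (Finset.mem_univ b) (hpos b)
        (fun k _ _ => (hpos k).le)
    rw [e1, e2, heq]
    have h3 : 1 < (∑ i, α i) * (1 / α a) := by
      rw [mul_one_div, one_lt_div (hpos a)]
      exact hlt
    have := mul_neg_of_pos_of_neg hg (sub_neg.2 h3)
    linarith
end
end

section
/- Let N_0,…,N_{d-1} be positive semidefinite n×n matrices with ∑_b N_b = 𝟙_n (a d-outcome POVM), and define its Fourier transforms B_k = ∑_{b=0}^{d-1} ω^{kb} N_b. If B_k is unitary (B_k†B_k = 𝟙_n) for every k = 1,…,d−1, then the POVM is projective, i.e. N_b N_{b'} = 0 for b ≠ b' and N_b² = N_b for all b, and moreover B_k = (B_1)^k for every k. -/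
open Matrix Kronecker Finset
open scoped ComplexOrder

noncomputable section

lemma aux_om_prim (d : ℕ) (hd : 2 ≤ d) : IsPrimitiveRoot (om d) d :=
  Complex.isPrimitiveRoot_exp d (by omega)

lemma aux_geom (d : ℕ) (hd : 2 ≤ d) (b c : Fin d) :
    ∑ k ∈ range d, star (om d ^ (k * (b : ℕ))) * om d ^ (k * (c : ℕ)) =
      if b = c then (d : ℂ) else 0 := by
  have hp := aux_om_prim d hd
  have hs : star (om d) * om d = 1 := by
    have := Complex.norm_eq_one_of_pow_eq_one hp.pow_eq_one (by omega)
    have h2 := Complex.conj_mul' (om d)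
    rw [this] at h2
    simpa using h2
  have hz : ∀ k, star (om d ^ (k * (b : ℕ))) * om d ^ (k * (c : ℕ)) =
      (star (om d) ^ (b : ℕ) * om d ^ (c : ℕ)) ^ k := by
    intro k
    rw [star_pow, mul_pow, ← pow_mul, ← pow_mul, mul_comm k, mul_comm k]
  simp_rw [hz]
  split_ifs with h
  · subst h
    rw [← mul_pow, hs]
    simp
  · have h1 : (star (om d) ^ (b : ℕ) * om d ^ (c : ℕ)) ≠ 1 := by
      intro h1
      apply h
      have : om d ^ (b : ℕ) = om d ^ (c : ℕ) := by
        calc om d ^ (b : ℕ) = om d ^ (b : ℕ) * (star (om d) ^ (b : ℕ) * om d ^ (c : ℕ)) := by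
              rw [h1, mul_one]
          _ = (star (om d) * om d) ^ (b : ℕ) * om d ^ (c : ℕ) := by rw [mul_pow]; ring
          _ = _ := by rw [hs, one_pow, one_mul]
      exact Fin.ext (hp.pow_inj b.2 c.2 this)
    have hd1 : (star (om d) ^ (b : ℕ) * om d ^ (c : ℕ)) ^ d = 1 := by
      rw [mul_pow, ← pow_mul, ← pow_mul, mul_comm (b : ℕ), mul_comm (c : ℕ), pow_mul, pow_mul,
        ← star_pow, hp.pow_eq_one]
      simp
    have := geom_sum_mul (star (om d) ^ (b : ℕ) * om d ^ (c : ℕ)) d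
    rw [hd1, sub_self] at this
    exact (mul_eq_zero.mp this).resolve_right (sub_ne_zero.mpr h1)

open scoped MatrixOrder in
lemma aux_fac {n : ℕ} (P : Matrix (Fin n) (Fin n) ℂ) (hP : P.PosSemidef) :
    ∃ X : Matrix (Fin n) (Fin n) ℂ, P = Xᴴ * X :=
  CStarAlgebra.nonneg_iff_eq_star_mul_self.mp hP.nonneg

lemma aux_tr {n : ℕ} (P Q : Matrix (Fin n) (Fin n) ℂ) (hP : P.PosSemidef) (hQ : Q.PosSemidef) :
    0 ≤ (P * Q).trace ∧ ((P * Q).trace = 0 → P * Q = 0) := by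
  obtain ⟨X, rfl⟩ := aux_fac _ hP
  obtain ⟨Y, rfl⟩ := aux_fac _ hQ
  have e : (Xᴴ * X * (Yᴴ * Y)).trace = ((Y * Xᴴ)ᴴ * (Y * Xᴴ)).trace := by
    rw [Matrix.mul_assoc, Matrix.trace_mul_comm]
    simp [Matrix.mul_assoc]
  rw [e]
  refine ⟨(Matrix.posSemidef_conjTranspose_mul_self _).trace_nonneg, fun h => ?_⟩
  have h0 := Matrix.trace_conjTranspose_mul_self_eq_zero_iff.mp h
  have h1 : X * Yᴴ = 0 := by
    have := congrArg conjTranspose h0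
    simpa using this
  calc Xᴴ * X * (Yᴴ * Y) = Xᴴ * (X * Yᴴ) * Y := by simp [Matrix.mul_assoc]
    _ = 0 := by simp [h1]

/-- if all the Fourier transforms `B_k = ∑_b ω^{kb} N_b` (k = 1,…,d−1) of a
d-outcome POVM `{N_b}` are unitary, then the POVM is projective (`N_b N_{b'} = 0` for `b ≠ b'`
and `N_b² = N_b`), and moreover `B_k = (B_1)^k` for every `k`. -/
theorem fourier_unitary_implies_projective (d n : ℕ) (hd : 2 ≤ d)
    (N : Fin d → Matrix (Fin n) (Fin n) ℂ)
    (hpsd : ∀ b, (N b).PosSemidef) (hsum : ∑ b, N b = 1)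
    (B : ℕ → Matrix (Fin n) (Fin n) ℂ)
    (hB : ∀ k, B k = ∑ b : Fin d, (om d ^ (k * (b : ℕ))) • N b)
    (huni : ∀ k, 1 ≤ k → k ≤ d - 1 → (B k)ᴴ * B k = 1) :
    (∀ b b' : Fin d, b ≠ b' → N b * N b' = 0) ∧ (∀ b, N b * N b = N b)
    ∧ (∀ k, k < d → B k = (B 1) ^ k) := by
  have hu : ∀ k ∈ range d, (B k)ᴴ * B k = 1 := by
    intro k hk
    rcases Nat.eq_zero_or_pos k with rfl | h
    · simp [hB, hsum]
    · exact huni k h (by have := mem_range.mp hk; omega)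
  have hsq : ∑ b, N b * N b = 1 := by
    have h1 : ∑ k ∈ range d, (B k)ᴴ * B k = (d : ℂ) • (1 : Matrix (Fin n) (Fin n) ℂ) := by
      rw [sum_congr rfl hu]
      simp [Nat.cast_smul_eq_nsmul]
    have h2 : ∑ k ∈ range d, (B k)ᴴ * B k = (d : ℂ) • ∑ b, N b * N b := by
      have e : ∀ k, (B k)ᴴ * B k = ∑ b : Fin d, ∑ c : Fin d,
          (star (om d ^ (k * (b : ℕ))) * om d ^ (k * (c : ℕ))) • (N b * N c) := by
        intro k
        rw [hB, conjTranspose_sum, Finset.sum_mul_sum]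
        refine sum_congr rfl fun b _ => sum_congr rfl fun c _ => ?_
        rw [conjTranspose_smul, (hpsd b).isHermitian.eq, smul_mul_smul_comm]
      simp_rw [e]
      rw [sum_comm, smul_sum]
      refine sum_congr rfl fun b _ => ?_
      rw [sum_comm]
      simp_rw [← sum_smul, aux_geom d hd]
      simp
    have hd0 : (d : ℂ) ≠ 0 := by
      have : d ≠ 0 := by omega
      exact_mod_cast this
    exact smul_right_injective _ hd0 (h2.symm.trans h1)
  have hoff : ∑ b, ∑ c ∈ univ.erase b, (N b * N c).trace = 0 := by
    have e : ∀ b, ∑ c ∈ univ.erase b, (N b * N c).trace = (N b).trace - (N b * N b).trace := by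
      intro b
      rw [eq_sub_iff_add_eq, sum_erase_add _ _ (mem_univ b), ← trace_sum, ← mul_sum, hsum, mul_one]
    simp_rw [e]
    rw [sum_sub_distrib, ← trace_sum, ← trace_sum, hsum, hsq, sub_self]
  have horth : ∀ b b' : Fin d, b ≠ b' → N b * N b' = 0 := by
    intro b c hbc
    have h1 := (sum_eq_zero_iff_of_nonneg (fun b _ => sum_nonneg fun c _ =>
      (aux_tr _ _ (hpsd b) (hpsd c)).1)).mp hoff b (mem_univ b)
    have h2 := (sum_eq_zero_iff_of_nonneg (fun c _ =>
      (aux_tr _ _ (hpsd b) (hpsd c)).1)).mp h1 c (by simp [hbc.symm])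
    exact (aux_tr _ _ (hpsd b) (hpsd c)).2 h2
  have hidem : ∀ b, N b * N b = N b := by
    intro b
    have : N b * ∑ c, N c = N b * N b := by
      rw [mul_sum]
      exact sum_eq_single b (fun c _ h => horth b c h.symm) (by simp)
    rw [← this, hsum, mul_one]
  refine ⟨horth, hidem, fun k _ => ?_⟩
  induction k with
  | zero => simp [hB, hsum]
  | succ k ih =>
    rw [pow_succ, ← ih (by omega), hB, hB k, hB 1, Finset.sum_mul_sum]
    refine sum_congr rfl fun b _ => ?_
    rw [sum_eq_single b]
    · rw [smul_mul_smul_comm, hidem, ← pow_add, add_mul]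
    · intro c _ h
      rw [smul_mul_smul_comm, horth b c h.symm, smul_zero]
    · simp
end
end

section
/- Let {B_k}_{k=0}^{d-1} be a Fourier family on ℂ^n, and let ψ ∈ ℂ^d ⊗ ℂ^n ⊗ ℂ^m be a unit vector whose reduced density matrix ρ_B on the middle factor is invertible. If (Z_d^k ⊗ B_k ⊗ 𝟙_m) ψ = ψ for every k = 1,…,d−1, then every B_k is unitary: B_k†B_k = 𝟙_n. -/
open Matrix Kronecker Finset
open scoped ComplexOrder

noncomputable section

/-- The reduced density matrix on the middle factor of a vector `ψ ∈ ℂ^d ⊗ ℂ^n ⊗ ℂ^m`: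
`ρ_B[b,b'] = ∑_{a,e} ψ_{a,b,e}·conj(ψ_{a,b',e})`. -/
def rhoB (d n m : ℕ) (ψ : (Fin d × Fin n) × Fin m → ℂ) : Matrix (Fin n) (Fin n) ℂ :=
  Matrix.of fun b b' => ∑ a : Fin d, ∑ e : Fin m, ψ ((a, b), e) * (starRingEnd ℂ) (ψ ((a, b'), e))


/-- if a unit vector `ψ ∈ ℂ^d ⊗ ℂ^n ⊗ ℂ^m` with invertible reduced state `ρ_B` is a
fixed point of `Z_d^k ⊗ B_k ⊗ 𝟙_m` for every k = 1,…,d−1, then every `B_k` is unitary. -/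
theorem fixed_points_imply_unitary (d n m : ℕ) [NeZero d] (hd : 2 ≤ d)
    (B : Fin d → Matrix (Fin n) (Fin n) ℂ) (hB : IsFourierFamily d n B)
    (ψ : (Fin d × Fin n) × Fin m → ℂ) (hψ : ∑ p, Complex.normSq (ψ p) = 1)
    (hrho : IsUnit (rhoB d n m ψ))
    (hfix : ∀ k : Fin d, (k : ℕ) ≠ 0 →
      (((Zd d ^ (k : ℕ)) ⊗ₖ B k) ⊗ₖ (1 : Matrix (Fin m) (Fin m) ℂ)).mulVec ψ = ψ) :
    ∀ k : Fin d, (B k)ᴴ * B k = 1 := by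
  obtain ⟨h0, -, hneg⟩ := hB
  intro k
  by_cases hk : (k : ℕ) = 0
  · rw [h0 k hk]; simp
  have key : ∀ j : Fin d, (j : ℕ) ≠ 0 → ∀ (a : Fin d) (e : Fin m),
      ((om d ^ (a : ℕ)) ^ (j : ℕ)) • (B j *ᵥ fun b => ψ ((a, b), e)) = fun b => ψ ((a, b), e) := by
    intro j hj a e
    funext b
    have h := congrFun (hfix j hj) ((a, b), e)
    rw [← h]
    simp [Matrix.mulVec, dotProduct, Fintype.sum_prod_type, Zd, Matrix.diagonal_pow,
      Matrix.diagonal_apply, Matrix.one_apply, Finset.mul_sum, ite_mul, mul_assoc]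
  have hnv : ((-k : Fin d) : ℕ) = d - k := by
    rw [Fin.val_neg', Nat.mod_eq_of_lt]
    have := k.isLt
    omega
  have hlt := k.isLt
  have hom : om d ^ d = 1 := by
    unfold om
    rw [← Complex.exp_nat_mul]
    have hd0 : (d : ℂ) ≠ 0 := by exact_mod_cast NeZero.ne d
    rw [mul_div_cancel₀ _ hd0, Complex.exp_two_pi_mul_I]
  have hv : ∀ (a : Fin d) (e : Fin m),
      ((B k)ᴴ * B k) *ᵥ (fun b => ψ ((a, b), e)) = fun b => ψ ((a, b), e) := by
    intro a e
    have h1 := key k hk a e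
    have h2 := key (-k) (by rw [hnv]; omega) a e
    rw [hneg, hnv] at h2
    generalize (fun b => ψ ((a, b), e)) = v at h1 h2 ⊢
    have hz : (om d ^ (a : ℕ)) ^ (d - (k : ℕ)) * (om d ^ (a : ℕ)) ^ (k : ℕ) = 1 := by
      rw [← pow_add, Nat.sub_add_cancel hlt.le, ← pow_mul, mul_comm, pow_mul, hom, one_pow]
    calc ((B k)ᴴ * B k) *ᵥ v
        = ((om d ^ (a : ℕ)) ^ (d - (k : ℕ)) * (om d ^ (a : ℕ)) ^ (k : ℕ)) •
            (((B k)ᴴ * B k) *ᵥ v) := by rw [hz, one_smul]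
      _ = (om d ^ (a : ℕ)) ^ (d - (k : ℕ)) •
            ((B k)ᴴ *ᵥ ((om d ^ (a : ℕ)) ^ (k : ℕ) • (B k *ᵥ v))) := by
          rw [Matrix.mulVec_smul, Matrix.mulVec_mulVec, smul_smul]
      _ = v := by rw [h1, h2]
  have hm : ((B k)ᴴ * B k) * rhoB d n m ψ = 1 * rhoB d n m ψ := by
    rw [one_mul]
    ext b b'
    generalize (B k)ᴴ * B k = M at hv ⊢
    simp only [Matrix.mul_apply, rhoB, Matrix.of_apply, Finset.mul_sum]
    rw [Finset.sum_comm]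
    refine Finset.sum_congr rfl fun a _ => ?_
    rw [Finset.sum_comm]
    refine Finset.sum_congr rfl fun e _ => ?_
    have h := congrFun (hv a e) b
    simp only [Matrix.mulVec, dotProduct] at h
    rw [← h, Finset.sum_mul]
    simp only [mul_assoc]
  exact hrho.mul_right_cancel hm
end
end
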